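/- arXiv:2209.06286 — 4 statements merged into one kernel-verified Lean document; each statement's English description precedes it below -/
import Mathlib

section
/- Let N ≥ 1, let c ∈ ℝᴺ with c_i ≠ 0 for all i, and let v ∈ ℝᴺ. Suppose S₁, …, S_L ⊆ {1,…,N} is a sequence of subsets and i₁,…,i_{L−1} ∈ {1,…,N} a sequence of indices such that for each s ∈ {1,…,L−1}, either S_{s+1} = S_s ∪ {i_s} with i_s ∉ S_s, or S_{s+1} = S_s ∖ {i_s} with i_s ∈ S_s; suppose further that every index in {1,…,N} occurs among i₁,…,i_{L−1}, and that ∑_{j ∈ S_s} v_j c_j = 0 for every s ∈ {1,…,L}. Then v = 0. -/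
/-- Core induction for step activations.  If the active sets
`S 0, …, S (L-1)` change by exactly one index `idx s` at each step, every index
of `Fin N` occurs among the crossing indices `idx 0, …, idx (L-2)`, and
`∑ j in S s, v j * c j = 0` on every region, then `v = 0`. -/
theorem step_active_set_induction
    {N : ℕ} (hN : 1 ≤ N) (L : ℕ)
    (c v : Fin N → ℝ) (hc : ∀ i, c i ≠ 0)
    (S : ℕ → Finset (Fin N)) (idx : ℕ → Fin N)
    (hstep : ∀ s, s + 1 < L →
      (idx s ∉ S s ∧ S (s + 1) = insert (idx s) (S s)) ∨
      (idx s ∈ S s ∧ S (s + 1) = (S s).erase (idx s)))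
    (hall : ∀ i : Fin N, ∃ s, s + 1 < L ∧ idx s = i)
    (hzero : ∀ s, s < L → ∑ j ∈ S s, v j * c j = 0) :
    v = 0 := by
  funext i
  obtain ⟨s, hs, rfl⟩ := hall i
  have hcur := hzero s (Nat.lt_of_succ_lt hs)
  have hnext := hzero (s + 1) hs
  have hprod : v (idx s) * c (idx s) = 0 := by
    rcases hstep s hs with ⟨hmem, hS⟩ | ⟨hmem, hS⟩
    · rw [hS, Finset.sum_insert hmem, hcur, add_zero] at hnext
      exact hnext
    · rw [hS] at hnext
      rw [← Finset.add_sum_erase _ _ hmem, hnext, add_zero] at hcur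
      exact hcur
  exact (mul_eq_zero.mp hprod).resolve_right (hc _)
end

section
/- Let N ≥ 1 and m ≥ 1, let u₁, …, u_N ∈ ℝᵐ be nonzero vectors, and let v ∈ ℝᴺ. Suppose S₁, …, S_L ⊆ {1,…,N} is a sequence of subsets and i₁,…,i_{L−1} ∈ {1,…,N} a sequence of indices such that for each s ∈ {1,…,L−1}, either S_{s+1} = S_s ∪ {i_s} with i_s ∉ S_s, or S_{s+1} = S_s ∖ {i_s} with i_s ∈ S_s; suppose further that every index in {1,…,N} occurs among i₁,…,i_{L−1}, and that ∑_{j ∈ S_s} v_j u_j = 0 ∈ ℝᵐ for every s ∈ {1,…,L}. Then v = 0. -/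
/-- Core induction for ReLU activations.  If the active sets
`S 0, …, S (L-1)` change by exactly one index `idx s` at each step, every index
of `Fin N` occurs among the crossing indices, the vectors `u j ∈ ℝᵐ` are nonzero,
and `∑ j in S s, v j • u j = 0` on every region, then `v = 0`. -/
theorem relu_active_set_induction
    {N m : ℕ} (hN : 1 ≤ N) (hm : 1 ≤ m) (L : ℕ)
    (u : Fin N → (Fin m → ℝ)) (hu : ∀ i, u i ≠ 0)
    (v : Fin N → ℝ)
    (S : ℕ → Finset (Fin N)) (idx : ℕ → Fin N)
    (hstep : ∀ s, s + 1 < L →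
      (idx s ∉ S s ∧ S (s + 1) = insert (idx s) (S s)) ∨
      (idx s ∈ S s ∧ S (s + 1) = (S s).erase (idx s)))
    (hall : ∀ i : Fin N, ∃ s, s + 1 < L ∧ idx s = i)
    (hzero : ∀ s, s < L → ∑ j ∈ S s, v j • u j = 0) :
    v = 0 := by
  funext i
  obtain ⟨s, hs, rfl⟩ := hall i
  have h₀ := hzero s (by omega)
  have h₁ := hzero (s + 1) hs
  have h : v (idx s) • u (idx s) = 0 := by
    rcases hstep s hs with ⟨hmem, hS⟩ | ⟨hmem, hS⟩
    · rwa [hS, Finset.sum_insert hmem, h₀, add_zero] at h₁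
    · rw [hS] at h₁
      rwa [← Finset.add_sum_erase _ _ hmem, h₁, add_zero] at h₀
  exact (smul_eq_zero.mp h).resolve_right (hu _)
end

section
/- Let A_r, P, Q be n × n real matrices with P and Q symmetric and P A_r + A_rᵀ P = −Q, let Γ be a symmetric invertible N × N real matrix, let B be an n × ℓ real matrix, and let φ : ℝ → ℝᴺ. Suppose e : ℝ → ℝⁿ and Θ̃ : ℝ → ℝ^{N×ℓ} are differentiable with ė_t = A_r e_t − B Θ̃_tᵀ φ_t and Θ̃̇_t = Γ φ_t e_tᵀ P B for all t. Then the function V(t) = e_tᵀ P e_t + tr(Θ̃_tᵀ Γ⁻¹ Θ̃_t) is differentiable with V̇(t) = −e_tᵀ Q e_t for all t. -/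
open Matrix

theorem Matrix.IsSymm.mulVec_dotProduct_comm {m : ℕ} {M : Matrix (Fin m) (Fin m) ℝ}
    (hM : M.IsSymm) (x y : Fin m → ℝ) : (M *ᵥ x) ⬝ᵥ y = x ⬝ᵥ (M *ᵥ y) := by
  rw [dotProduct_mulVec, ← mulVec_transpose, hM.eq]

theorem HasDerivAt.dotProduct_mulVec_self {m : ℕ} {M : Matrix (Fin m) (Fin m) ℝ}
    (hM : M.IsSymm) {u : ℝ → Fin m → ℝ} {u' : Fin m → ℝ} {t : ℝ} (hu : HasDerivAt u u' t) :
    HasDerivAt (fun s => u s ⬝ᵥ (M *ᵥ u s)) (2 * (u' ⬝ᵥ (M *ᵥ u t))) t := by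
  have hcoord := hasDerivAt_pi.1 hu
  have hMu : ∀ i, HasDerivAt (fun s => (M *ᵥ u s) i) ((M *ᵥ u') i) t := by
    intro i
    simp only [mulVec, dotProduct]
    exact HasDerivAt.fun_sum fun j _ => (hcoord j).const_mul (M i j)
  have hsum : HasDerivAt (fun s => u s ⬝ᵥ (M *ᵥ u s))
      (∑ i, (u' i * (M *ᵥ u t) i + u t i * (M *ᵥ u') i)) t := by
    simp only [dotProduct]
    exact HasDerivAt.fun_sum fun i _ => (hcoord i).mul (hMu i)
  refine hsum.congr_deriv ?_
  rw [Finset.sum_add_distrib]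
  change u' ⬝ᵥ (M *ᵥ u t) + u t ⬝ᵥ (M *ᵥ u') = _
  rw [← hM.mulVec_dotProduct_comm (u t), dotProduct_comm (M *ᵥ u t)]
  ring

theorem Matrix.trace_transpose_mul_mul_eq_sum {N ℓ : ℕ} (M : Matrix (Fin N) (Fin N) ℝ)
    (X : Matrix (Fin N) (Fin ℓ) ℝ) :
    trace (Xᵀ * M * X) = ∑ j, X.col j ⬝ᵥ (M *ᵥ X.col j) := by
  rw [Matrix.mul_assoc]
  rfl

/-- Lyapunov computation for MRAC.  With error dynamics
`ė = A_r e − B Θ̃ᵀ φ` and adaptation law `Θ̃̇ = Γ φ eᵀ P B`, where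
`P A_r + A_rᵀ P = −Q`, the function `V(t) = eᵀPe + tr(Θ̃ᵀ Γ⁻¹ Θ̃)` has
derivative `V̇(t) = −eᵀQe`. -/
theorem mrac_lyapunov_derivative
    {n N ℓ : ℕ}
    (Ar P Q : Matrix (Fin n) (Fin n) ℝ)
    (hP : P.IsSymm) (hQ : Q.IsSymm)
    (hLyap : P * Ar + Arᵀ * P = -Q)
    (Γ : Matrix (Fin N) (Fin N) ℝ) (hΓ : Γ.IsSymm) (hΓinv : IsUnit Γ.det)
    (B : Matrix (Fin n) (Fin ℓ) ℝ)
    (φ : ℝ → (Fin N → ℝ))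
    (e : ℝ → (Fin n → ℝ)) (Θt : ℝ → (Fin N → Fin ℓ → ℝ))
    (he : ∀ t : ℝ, HasDerivAt e (Ar *ᵥ e t - B *ᵥ ((Matrix.of (Θt t))ᵀ *ᵥ φ t)) t)
    (hΘ : ∀ t : ℝ, HasDerivAt Θt
      (fun i j => (Γ *ᵥ φ t) i * ((e t) ᵥ* (P * B)) j) t) :
    ∀ t : ℝ, HasDerivAt
      (fun s => e s ⬝ᵥ (P *ᵥ e s) + Matrix.trace ((Matrix.of (Θt s))ᵀ * Γ⁻¹ * Matrix.of (Θt s)))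
      (-(e t ⬝ᵥ (Q *ᵥ e t))) t := by
  intro t
  set v := (Matrix.of (Θt t))ᵀ *ᵥ φ t with hv
  set w := e t ᵥ* (P * B) with hw
  have hΓinv_symm : (Γ⁻¹).IsSymm := by
    rw [Matrix.IsSymm, Matrix.transpose_nonsing_inv, hΓ.eq]
  have htrack := (he t).dotProduct_mulVec_self hP
  have hcol : ∀ j, HasDerivAt (fun s => (Matrix.of (Θt s)).col j) (w j • (Γ *ᵥ φ t)) t := by
    intro j
    refine hasDerivAt_pi.2 fun i => ?_
    exact (hasDerivAt_pi.1 (hasDerivAt_pi.1 (hΘ t) i) j).congr_deriv (mul_comm _ _)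
  have hparam : HasDerivAt
      (fun s => Matrix.trace ((Matrix.of (Θt s))ᵀ * Γ⁻¹ * Matrix.of (Θt s)))
      (2 * (w ⬝ᵥ v)) t := by
    simp only [Matrix.trace_transpose_mul_mul_eq_sum]
    refine (HasDerivAt.fun_sum fun j _ =>
      (hcol j).dotProduct_mulVec_self hΓinv_symm).congr_deriv ?_
    rw [← Finset.mul_sum]
    congr 1
    refine Finset.sum_congr rfl fun j _ => ?_
    rw [smul_dotProduct, hΓ.mulVec_dotProduct_comm, mulVec_mulVec,
      Matrix.mul_nonsing_inv _ hΓinv, one_mulVec, dotProduct_comm]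
    rfl
  have hcross : (B *ᵥ v) ⬝ᵥ (P *ᵥ e t) = w ⬝ᵥ v := by
    rw [← hP.mulVec_dotProduct_comm, mulVec_mulVec, dotProduct_comm, dotProduct_mulVec]
  have hquad : 2 * ((Ar *ᵥ e t) ⬝ᵥ (P *ᵥ e t)) = -(e t ⬝ᵥ (Q *ᵥ e t)) := by
    rw [← dotProduct_neg, ← neg_mulVec, ← hLyap, add_mulVec, dotProduct_add,
      ← mulVec_mulVec, ← mulVec_mulVec, ← hP.mulVec_dotProduct_comm (e t),
      dotProduct_comm (P *ᵥ e t), dotProduct_mulVec (e t), vecMul_transpose]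
    ring
  refine (htrack.add hparam).congr_deriv ?_
  rw [sub_dotProduct, hcross, mul_sub, hquad]
  ring
end

section
/- Let A, A_r, B, B_r, K_x, K_r satisfy the matching conditions A + B K_xᵀ = A_r and B K_rᵀ = B_r, where A, A_r are n × n, B is n × ℓ, B_r is n × ℓ, K_x is n × ℓ, K_r is ℓ × ℓ. Let φ : ℝⁿ → ℝᴺ, let Θ, Θ̂_t ∈ ℝ^{N×ℓ}, and let r : ℝ → ℝˡ. Suppose x : ℝ → ℝⁿ and x^r : ℝ → ℝⁿ are differentiable and satisfy ẋ_t = A x_t + B(u_t + Θᵀ φ(x_t)) with the control law u_t = K_xᵀ x_t + K_rᵀ r_t − Θ̂_tᵀ φ(x_t), and ẋ^r_t = A_r x^r_t + B_r r_t. Then the tracking error e_t = x_t − x^r_t satisfies ė_t = A_r e_t − B (Θ̂_t − Θ)ᵀ φ(x_t). -/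
open Matrix

/-- Closed-loop tracking-error dynamics in MRAC.  Under the
matching conditions `A + BK_xᵀ = A_r`, `BK_rᵀ = B_r` and the control law
`u = K_xᵀx + K_rᵀr − Θ̂ᵀφ(x)`, the tracking error `e = x − xʳ` satisfies
`ė = A_r e − B(Θ̂ − Θ)ᵀφ(x)`. -/
theorem mrac_tracking_error_dynamics
    {n ℓ N : ℕ}
    (A Ar : Matrix (Fin n) (Fin n) ℝ) (B Br : Matrix (Fin n) (Fin ℓ) ℝ)
    (Kx : Matrix (Fin n) (Fin ℓ) ℝ) (Kr : Matrix (Fin ℓ) (Fin ℓ) ℝ)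
    (hmatchA : A + B * Kxᵀ = Ar) (hmatchB : B * Krᵀ = Br)
    (φ : (Fin n → ℝ) → (Fin N → ℝ))
    (Θ : Matrix (Fin N) (Fin ℓ) ℝ) (Θhat : ℝ → Matrix (Fin N) (Fin ℓ) ℝ)
    (r : ℝ → (Fin ℓ → ℝ))
    (x xr : ℝ → (Fin n → ℝ))
    (u : ℝ → (Fin ℓ → ℝ))
    (hu : ∀ t, u t = Kxᵀ *ᵥ x t + Krᵀ *ᵥ r t - (Θhat t)ᵀ *ᵥ φ (x t))
    (hx : ∀ t : ℝ, HasDerivAt x (A *ᵥ x t + B *ᵥ (u t + Θᵀ *ᵥ φ (x t))) t)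
    (hxr : ∀ t : ℝ, HasDerivAt xr (Ar *ᵥ xr t + Br *ᵥ r t) t) :
    ∀ t : ℝ, HasDerivAt (fun s => x s - xr s)
      (Ar *ᵥ (x t - xr t) - B *ᵥ ((Θhat t - Θ)ᵀ *ᵥ φ (x t))) t := by
  intro t
  have h : Ar *ᵥ (x t - xr t) - B *ᵥ ((Θhat t - Θ)ᵀ *ᵥ φ (x t)) =
      A *ᵥ x t + B *ᵥ (u t + Θᵀ *ᵥ φ (x t)) - (Ar *ᵥ xr t + Br *ᵥ r t) := by
    simp only [hu, ← hmatchA, ← hmatchB, transpose_sub, mulVec_sub, sub_mulVec, mulVec_add,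
      add_mulVec, mulVec_mulVec]
    abel
  rw [h]
  exact (hx t).fun_sub (hxr t)
end
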